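/- Let k be a perfect field, let C be a commutative k-algebra of finite type, let A be a commutative ring which is of finite type over some field and whose prime spectrum is connected (hence nonempty), and let φ : C → A be a ring homomorphism. Then there exist: (i) a field l and a ring homomorphism χ : l → A making A an l-algebra of finite type; (ii) a ring homomorphism ι : k → l with χ ∘ ι = φ ∘ (algebraMap k C); (iii) a k-subalgebra R of l (k acting via ι) which is an integral domain of finite type over k, whose field of fractions m embeds in l as the subfield generated by R; (iv) a finite type R-algebra B₀ and a k-algebra homomorphism ψ : C → B₀; (v) an isomorphism of l-algebras Θ : l ⊗_m (m ⊗_R B₀) ≅ A, where m = Frac(R) ⊆ l, such that Θ(1 ⊗ (1 ⊗ ψ(c))) = φ(c) for all c ∈ C. -/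

import Mathlib

set_option synthInstance.maxHeartbeats 1000000
set_option maxHeartbeats 2000000
open TensorProduct

theorem subsingleton_h1Cotangent_iff_forall_mem_ker_sq {R S : Type*} [CommRing R] [CommRing S]
    [Algebra R S] :
    Subsingleton (Algebra.H1Cotangent R S) ↔
      ∀ f : MvPolynomial S R, MvPolynomial.aeval (id : S → S) f = 0 →
        (∀ i, MvPolynomial.aeval (id : S → S) (MvPolynomial.pderiv i f) = 0) →
          f ∈ RingHom.ker (MvPolynomial.aeval (R := R) (id : S → S)) ^ 2 := by
  let P := Algebra.Generators.self R S
  have key : ∀ f : P.toExtension.ker, P.toExtension.cotangentComplex (.mk f) = 0 ↔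
      ∀ i, MvPolynomial.aeval (id : S → S) (MvPolynomial.pderiv i f.1) = 0 := by
    intro f
    rw [← P.cotangentSpaceBasis.repr.map_eq_zero_iff, Algebra.Extension.cotangentComplex_mk,
      Finsupp.ext_iff]
    refine forall_congr' fun i ↦ ?_
    erw [P.cotangentSpaceBasis_repr_one_tmul]
    rfl
  have hker : ∀ f : MvPolynomial S R, f ∈ P.toExtension.ker ↔ MvPolynomial.aeval (id : S → S) f = 0 :=
    fun f ↦ Iff.rfl
  have hI : P.toExtension.ker = RingHom.ker (MvPolynomial.aeval (R := R) (id : S → S)) := rfl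
  rw [Algebra.Extension.subsingleton_h1Cotangent, injective_iff_map_eq_zero]
  constructor
  · intro h f hf hf'
    have := h (.mk ⟨f, (hker f).2 hf⟩) ((key _).2 hf')
    rwa [Algebra.Extension.Cotangent.mk_eq_zero_iff] at this
  · intro h x hx
    obtain ⟨f, rfl⟩ := Algebra.Extension.Cotangent.mk_surjective x
    rw [Algebra.Extension.Cotangent.mk_eq_zero_iff]
    exact h f.1 f.2 ((key _).1 hx)

/-- Every field extension of a perfect field is formally smooth. -/
theorem formallySmooth_of_perfectField {k L : Type*} [Field k] [PerfectField k] [Field L]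
    [Algebra k L] : Algebra.FormallySmooth k L := by
  refine ⟨inferInstance, subsingleton_h1Cotangent_iff_forall_mem_ker_sq.2 fun f hf hf' ↦ ?_⟩
  let K := IntermediateField.adjoin k (f.vars : Set L)
  have hK : Algebra.EssFiniteType k K :=
    IntermediateField.essFiniteType_iff.2 (IntermediateField.fg_adjoin_finset _)
  have h1 := (Algebra.FormallySmooth.of_perfectField (K := k) (L := K)).subsingleton_h1Cotangent
  rw [subsingleton_h1Cotangent_iff_forall_mem_ker_sq] at h1
  obtain ⟨g, hgf⟩ : ∃ g : MvPolynomial K k, MvPolynomial.rename (algebraMap K L) g = f :=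
    MvPolynomial.exists_rename_eq_of_vars_subset_range f _ (algebraMap K L).injective
      fun x hx ↦ ⟨⟨x, IntermediateField.subset_adjoin _ _ hx⟩, rfl⟩
  have hcomm : ∀ p : MvPolynomial K k, MvPolynomial.aeval (id : L → L)
      (MvPolynomial.rename (algebraMap K L) p) =
        algebraMap K L (MvPolynomial.aeval (id : K → K) p) := by
    intro p
    rw [MvPolynomial.aeval_rename, ← MvPolynomial.aeval_algebraMap_apply]
    rfl
  have hg := h1 g (by
    rw [← hgf, hcomm] at hf
    exact (map_eq_zero (algebraMap K L)).1 hf) fun i ↦ by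
    have := hf' (algebraMap K L i)
    rw [← hgf, MvPolynomial.pderiv_rename (algebraMap K L).injective, hcomm] at this
    exact (map_eq_zero (algebraMap K L)).1 this
  have := Ideal.mem_map_of_mem (MvPolynomial.rename (R := k) (algebraMap K L)) hg
  rw [Ideal.map_pow] at this
  rw [← hgf]
  refine Ideal.pow_right_mono (Ideal.map_le_iff_le_comap.2 fun p hp ↦ ?_) 2 this
  rw [RingHom.mem_ker] at hp
  rw [Ideal.mem_comap, RingHom.mem_ker, hcomm, hp, map_zero]

open PrimeSpectrum in
theorem exists_forall_notMem_mem_range_comap {R S : Type*} [CommRing R] [IsDomain R] [CommRing S]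
    {f : R →+* S} (hf : f.FinitePresentation) (hinj : Function.Injective f) :
    ∃ g : R, g ≠ 0 ∧ ∀ P : PrimeSpectrum R, g ∉ P.asIdeal → P ∈ Set.range (comap f) := by
  obtain ⟨s, hs⟩ := exists_constructibleSetData_iff.2 (isConstructible_range_comap hf)
  obtain ⟨p, hp, hp'⟩ := Ideal.exists_comap_eq_of_mem_minimalPrimes_of_injective hinj ⊥
    (by rw [IsDomain.minimalPrimes_eq_singleton_bot]; rfl)
  have h0 : (⊥ : PrimeSpectrum R) ∈ s.toSet := by
    rw [hs]
    exact ⟨⟨p, hp⟩, PrimeSpectrum.ext hp'⟩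
  obtain ⟨C, hC, h1, h2⟩ := Set.mem_iUnion₂.1 h0
  refine ⟨C.f, fun h ↦ h2 (by simp [h]), fun P hP ↦ ?_⟩
  rw [← hs]
  refine Set.mem_iUnion₂.2 ⟨C, hC, fun x hx ↦ ?_, by simpa using hP⟩
  have : x = 0 := h1 hx
  simp [this]

open Polynomial PrimeSpectrum in
/-- A subfield of an algebra of finite type over a field `F` consists of elements integral over `F`. -/
theorem isIntegral_of_mem_range_of_field {F A K : Type*} [Field F] [CommRing A] [Algebra F A]
    [Algebra.FiniteType F A] [Field K] (φ : K →+* A) (c : K) : IsIntegral F (φ c) := by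
  rcases subsingleton_or_nontrivial A with hA | hA
  · exact ⟨1, monic_one, Subsingleton.elim _ _⟩
  by_contra hφc
  have hinj : Function.Injective (aeval (R := F) (φ c)) :=
    transcendental_iff_injective.1 fun h ↦ hφc h.isIntegral
  have hfp : (aeval (R := F) (φ c)).toRingHom.FinitePresentation := by
    refine RingHom.FinitePresentation.of_finiteType.1 ?_
    refine RingHom.FiniteType.of_comp_finiteType (f := (C : F →+* F[X])) ?_
    convert! (RingHom.finiteType_algebraMap (A := F) (B := A)).2 inferInstance
    ext x
    simp
  obtain ⟨g, hg, H⟩ := exists_forall_notMem_mem_range_comap hfp hinj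
  have hroot : ∀ n : ℕ, n ≠ 0 → ∀ ζ : AlgebraicClosure F, ζ ^ n = 1 → aeval ζ g = 0 := by
    intro n hn ζ hζ
    by_contra hgζ
    obtain ⟨q, hq⟩ := H ⟨RingHom.ker (aeval (R := F) ζ), RingHom.ker_isPrime _⟩ hgζ
    have hmem : (X ^ n - 1 : F[X]) ∈ RingHom.ker (aeval (R := F) ζ) := by
      rw [RingHom.mem_ker]
      simp [hζ]
    have hq' := congrArg PrimeSpectrum.asIdeal hq
    simp only at hq'
    rw [← hq'] at hmem
    have hmem' : φ (c ^ n - 1) ∈ q.asIdeal := by simpa using hmem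
    by_cases hc : c ^ n - 1 = 0
    · refine hφc ⟨X ^ n - 1, monic_X_pow_sub_C 1 hn, ?_⟩
      have := congrArg φ hc
      simpa using this
    · exact q.2.ne_top (Ideal.eq_top_of_isUnit_mem _ hmem' ((Ne.isUnit hc).map φ))
  obtain ⟨n, hn, hnF⟩ : ∃ n : ℕ, g.natDegree < n ∧ (n : AlgebraicClosure F) ≠ 0 := by
    by_contra! h
    have h1 := h (g.natDegree + 1) (by lia)
    have h2 := h (g.natDegree + 2) (by lia)
    push_cast at h1 h2
    exact one_ne_zero (α := AlgebraicClosure F) (by linear_combination h2 - h1)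
  have : NeZero (n : AlgebraicClosure F) := ⟨hnF⟩
  obtain ⟨ζ, hζ⟩ := (IsSepClosed.hasEnoughRootsOfUnity (AlgebraicClosure F) n).exists_primitiveRoot
  have hle : (nthRootsFinset n (1 : AlgebraicClosure F)).val ≤
      (g.map (algebraMap F (AlgebraicClosure F))).roots := by
    refine Multiset.le_iff_subset (Finset.nodup _) |>.2 fun x hx ↦ ?_
    rw [mem_roots (by simpa using hg), IsRoot.def, eval_map_algebraMap]
    exact hroot n (by lia) x ((mem_nthRootsFinset (by lia) _).1 hx)
  have hcard := (Multiset.card_le_card hle).trans (card_roots' _)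
  rw [natDegree_map, Finset.card_val, hζ.card_nthRootsFinset] at hcard
  lia

theorem isField_of_isIntegral_of_isIdempotentElem {F S : Type*} [Field F] [CommRing S]
    [IsReduced S] [Nontrivial S] [Algebra F S] [Algebra.IsIntegral F S]
    (h : ∀ e : S, IsIdempotentElem e → e = 0 ∨ e = 1) : IsField S := by
  refine ⟨exists_pair_ne S, mul_comm, fun {x} hx ↦ ?_⟩
  obtain ⟨p, hp, hpx⟩ := Algebra.IsIntegral.isIntegral (R := F) x
  obtain ⟨q, hpq, hq⟩ := Polynomial.exists_eq_pow_rootMultiplicity_mul_and_not_dvd p hp.ne_zero 0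
  rw [map_zero, sub_zero] at hpq hq
  rw [Polynomial.X_dvd_iff] at hq
  set n := p.rootMultiplicity 0
  replace hpx : Polynomial.aeval x p = 0 := hpx
  rw [hpq, ← Polynomial.divX_mul_X_add q] at hpx
  simp only [map_mul, map_pow, Polynomial.aeval_X, map_add, Polynomial.aeval_C] at hpx
  set y := Polynomial.aeval x q.divX
  set b := algebraMap F S (q.coeff 0)
  set c := algebraMap F S (q.coeff 0)⁻¹
  have hbc : b * c = 1 := by rw [← map_mul, mul_inv_cancel₀ hq, map_one]
  have hz : x * (y * x + b) = 0 := by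
    generalize y * x + b = w at hpx
    refine (pow_eq_zero_iff n.add_one_ne_zero).1 ?_
    linear_combination x * w ^ n * hpx
  have he : IsIdempotentElem (-(x * y * c)) := by
    unfold IsIdempotentElem
    linear_combination (y * c ^ 2) * hz - (x * y * c) * hbc
  have hxe : x * -(x * y * c) = x := by linear_combination - c * hz + x * hbc
  rcases h _ he with h | h
  · rw [h, mul_zero] at hxe
    exact absurd hxe.symm hx
  · exact ⟨-(y * c), by linear_combination h⟩

theorem finiteType_of_finiteType_quotient_of_isNilpotent {R A : Type*} [CommRing R] [CommRing A]
    [Algebra R A] (I : Ideal A) (hI : I.FG) (hnil : IsNilpotent I)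
    [h : Algebra.FiniteType R (A ⧸ I)] : Algebra.FiniteType R A := by
  classical
  obtain ⟨s, hs⟩ := h.out
  obtain ⟨t, ht⟩ := hI
  let f := Function.surjInv (Ideal.Quotient.mk_surjective (I := I))
  have hf : ∀ x, Ideal.Quotient.mk I (f x) = x := Function.surjInv_eq _
  let S := Algebra.adjoin R ((s.image f ∪ t : Finset A) : Set A)
  have hmap : S.map (Ideal.Quotient.mkₐ R I) = ⊤ := by
    rw [eq_top_iff, ← hs, Algebra.adjoin_le_iff]
    intro x hx
    exact ⟨f x, Algebra.subset_adjoin (by simp; exact Or.inl ⟨x, hx, rfl⟩), hf x⟩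
  have hS : ∀ a : A, ∃ b ∈ S, a - b ∈ I := by
    intro a
    obtain ⟨b, hb, hba⟩ : Ideal.Quotient.mkₐ R I a ∈ S.map (Ideal.Quotient.mkₐ R I) :=
      hmap ▸ Algebra.mem_top
    exact ⟨b, hb, Ideal.Quotient.eq.1 hba.symm⟩
  let J : Ideal S := I.comap (algebraMap S A)
  have hJ : J.map (algebraMap S A) = I := by
    refine le_antisymm Ideal.map_comap_le ?_
    rw [← ht, Ideal.span_le]
    intro x hx
    have hxS : x ∈ S := Algebra.subset_adjoin (by simp [Finset.mem_coe.1 hx])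
    refine Ideal.mem_map_of_mem (algebraMap S A) (x := ⟨x, hxS⟩) ?_
    rw [Ideal.mem_comap, ← ht]
    exact Ideal.subset_span hx
  have hstep : ∀ n, ∀ a ∈ I ^ n, ∃ b ∈ S, a - b ∈ I ^ (n + 1) := by
    intro n a ha
    rw [← hJ, ← Ideal.map_pow] at ha
    refine Submodule.span_induction (p := fun a _ ↦ ∃ b ∈ S, a - b ∈ I ^ (n + 1)) ?_ ?_ ?_ ?_ ha
    · rintro _ ⟨x, -, rfl⟩
      exact ⟨x, x.2, by simp⟩
    · exact ⟨0, zero_mem _, by simp⟩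
    · rintro x y - - ⟨b, hb, hb'⟩ ⟨c, hc, hc'⟩
      exact ⟨b + c, add_mem hb hc, by simpa [add_sub_add_comm] using add_mem hb' hc'⟩
    · rintro c x hx ⟨b, hb, hb'⟩
      obtain ⟨d, hd, hd'⟩ := hS c
      refine ⟨d * b, mul_mem hd hb, ?_⟩
      change x ∈ (J ^ n).map (algebraMap S A) at hx
      rw [Ideal.map_pow, hJ] at hx
      have h1 : (c - d) * x ∈ I ^ (n + 1) := pow_succ' I n ▸ Ideal.mul_mem_mul hd' hx
      convert! add_mem h1 ((I ^ (n + 1)).mul_mem_left d hb') using 1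
      rw [smul_eq_mul]
      ring
  have hall : ∀ n, ∀ a, ∃ b ∈ S, a - b ∈ I ^ n := by
    intro n
    induction n with
    | zero => exact fun a ↦ ⟨0, zero_mem _, by simp⟩
    | succ n ih =>
      intro a
      obtain ⟨b, hb, hb'⟩ := ih a
      obtain ⟨c, hc, hc'⟩ := hstep n _ hb'
      exact ⟨b + c, add_mem hb hc, by rwa [← sub_sub]⟩
  obtain ⟨n, hn⟩ := hnil
  refine ⟨⟨s.image f ∪ t, eq_top_iff.2 fun a _ ↦ ?_⟩⟩
  obtain ⟨b, hb, hab⟩ := hall n a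
  rw [hn, Ideal.zero_eq_bot, Ideal.mem_bot, sub_eq_zero] at hab
  exact hab ▸ hb

section
variable {k R l E A : Type*} [CommRing k] [CommRing R] [CommRing l] [CommRing E] [CommRing A]
  [Algebra k R] [Algebra k l] [Algebra R l] [IsScalarTower k R l] [Algebra k E] [Algebra k A]
  [Algebra l A] [IsScalarTower k l A]

theorem exists_algEquiv_tensorProduct_quotient (π : l ⊗[k] E →ₐ[l] A)
    (hπ : Function.Surjective π) (J : Ideal (R ⊗[k] E))
    (hJ : J.map (Algebra.TensorProduct.map (IsScalarTower.toAlgHom k R l) (AlgHom.id k E)) =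
      RingHom.ker π) :
    ∃ Θ : (l ⊗[R] ((R ⊗[k] E) ⧸ J)) ≃ₐ[l] A,
      ∀ e : E, Θ (1 ⊗ₜ Ideal.Quotient.mk J (1 ⊗ₜ e)) = π (1 ⊗ₜ e) := by
  let _ : Algebra R A := ((algebraMap l A).comp (algebraMap R l)).toAlgebra
  have : IsScalarTower R l A := .of_algebraMap_eq fun _ ↦ rfl
  have : IsScalarTower k R A := .of_algebraMap_eq fun x ↦ by
    rw [IsScalarTower.algebraMap_apply R l A, ← IsScalarTower.algebraMap_apply k R l,
      ← IsScalarTower.algebraMap_apply k l A]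
  let ρ : R ⊗[k] E →ₐ[R] l ⊗[k] E :=
    Algebra.TensorProduct.map (Algebra.ofId R l) (AlgHom.id k E)
  have hρ : ∀ x, ρ x = Algebra.TensorProduct.map (IsScalarTower.toAlgHom k R l) (AlgHom.id k E) x :=
    fun _ ↦ rfl
  let β : ((R ⊗[k] E) ⧸ J) →ₐ[R] A := Ideal.Quotient.liftₐ J ((π.restrictScalars R).comp ρ)
    fun a ha ↦ by
      have : ρ a ∈ RingHom.ker π := hJ ▸ Ideal.mem_map_of_mem _ ha
      exact this
  let Θ : (l ⊗[R] ((R ⊗[k] E) ⧸ J)) →ₐ[l] A :=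
    Algebra.TensorProduct.lift (Algebra.ofId l A) β fun _ _ ↦ .all _ _
  let σ : l ⊗[k] E →ₐ[l] l ⊗[R] ((R ⊗[k] E) ⧸ J) :=
    Algebra.TensorProduct.lift (Algebra.ofId _ _)
      (((Algebra.TensorProduct.includeRight.comp (Ideal.Quotient.mkₐ R J)).restrictScalars k).comp
        Algebra.TensorProduct.includeRight) fun _ _ ↦
        mul_comm (G := l ⊗[R] ((R ⊗[k] E) ⧸ J)) _ _
  have hσ : ∀ (x : l) (e : E), σ (x ⊗ₜ e) = x ⊗ₜ Ideal.Quotient.mk J (1 ⊗ₜ e) := by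
    intro x e
    refine (Algebra.TensorProduct.lift_tmul _ _ _ _ _).trans ?_
    change (x ⊗ₜ 1 : l ⊗[R] ((R ⊗[k] E) ⧸ J)) * (1 ⊗ₜ Ideal.Quotient.mk J (1 ⊗ₜ e)) = _
    rw [Algebra.TensorProduct.tmul_mul_tmul, one_mul, mul_one]
  have hΘσ : ∀ z, Θ (σ z) = π z := by
    intro z
    refine DFunLike.congr_fun (f := Θ.comp σ) (g := π) ?_ z
    ext e
    simp [Θ, hσ]
    change π (ρ (1 ⊗ₜ e)) = _
    simp [ρ]
  have hσρ : ∀ t, σ (ρ t) = 1 ⊗ₜ Ideal.Quotient.mk J t := by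
    intro t
    refine DFunLike.congr_fun (f := (σ.restrictScalars R).comp ρ)
      (g := Algebra.TensorProduct.includeRight.comp (Ideal.Quotient.mkₐ R J)) ?_ t
    ext e
    simp [ρ, hσ]
  have hσsurj : Function.Surjective σ := by
    intro y
    induction y with
    | zero => exact ⟨0, map_zero _⟩
    | add a b ha hb =>
      obtain ⟨a, rfl⟩ := ha
      obtain ⟨b, rfl⟩ := hb
      exact ⟨a + b, map_add _ _ _⟩
    | tmul x t =>
      obtain ⟨t, rfl⟩ := Ideal.Quotient.mk_surjective t
      exact ⟨x • ρ t, by rw [map_smul, hσρ, smul_tmul', smul_eq_mul, mul_one]⟩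
  have hker : RingHom.ker π ≤ RingHom.ker σ := by
    rw [← hJ, Ideal.map_le_iff_le_comap]
    intro t ht
    rw [Ideal.mem_comap, RingHom.mem_ker, ← hρ, hσρ, Ideal.Quotient.eq_zero_iff_mem.2 ht, tmul_zero]
  have hbij : Function.Bijective Θ := by
    refine ⟨(injective_iff_map_eq_zero _).2 fun y hy ↦ ?_, fun a ↦ ?_⟩
    · obtain ⟨z, rfl⟩ := hσsurj y
      exact hker ((hΘσ z).symm.trans hy)
    · obtain ⟨z, rfl⟩ := hπ a
      exact ⟨σ z, hΘσ z⟩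
  exact ⟨AlgEquiv.ofBijective Θ hbij, fun e ↦ by rw [← hσ]; exact hΘσ _⟩
end

theorem exists_adjoin_forall_mem_range_map {k l E : Type*} [CommRing k] [CommRing l] [CommRing E]
    [Algebra k l] [Algebra k E] (s : Finset (l ⊗[k] E)) :
    ∃ t : Finset l, ∀ x ∈ s, x ∈ (Algebra.TensorProduct.map
      (IsScalarTower.toAlgHom k (Algebra.adjoin k (t : Set l)) l) (AlgHom.id k E)).range := by
  obtain ⟨M, hM, hs⟩ := TensorProduct.exists_finite_submodule_left_of_setFinite _ s.finite_toSet
  obtain ⟨t, rfl⟩ := Module.Finite.iff_fg.1 hM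
  refine ⟨t, fun x hx ↦ ?_⟩
  obtain ⟨y, rfl⟩ := hs hx
  clear hx
  refine ⟨(Submodule.inclusion (Algebra.span_le_adjoin k (t : Set l))).rTensor E y, ?_⟩
  induction y with
  | zero => simp
  | add a b ha hb => simp_all
  | tmul a b => rfl

theorem exists_surjective_tensorProduct_mvPolynomial {k l C A : Type*} [CommRing k] [CommRing l]
    [CommRing C] [CommRing A] [Algebra k l] [Algebra k C] [Algebra k A] [Algebra l A]
    [IsScalarTower k l A] [h : Algebra.FiniteType l A] (φ : C →ₐ[k] A) :
    ∃ (n : ℕ) (π : l ⊗[k] MvPolynomial (Fin n) C →ₐ[l] A), Function.Surjective π ∧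
      ∀ c, π (1 ⊗ₜ MvPolynomial.C c) = φ c := by
  obtain ⟨n, f, hf⟩ := Algebra.FiniteType.iff_quotient_mvPolynomial''.1 h
  let _ : Algebra C A := φ.toRingHom.toAlgebra
  have : IsScalarTower k C A := .of_algebraMap_eq fun x ↦ (φ.commutes x).symm
  let π : l ⊗[k] MvPolynomial (Fin n) C →ₐ[l] A := Algebra.TensorProduct.lift (Algebra.ofId l A)
    ((MvPolynomial.aeval (R := C) fun i ↦ f (MvPolynomial.X i)).restrictScalars k)
    fun _ _ ↦ .all _ _
  refine ⟨n, π, ?_, fun c ↦ ?_⟩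
  · have : f = π.comp (MvPolynomial.aeval fun i ↦ 1 ⊗ₜ MvPolynomial.X i) := by
      ext i
      simp [π]
    rw [this] at hf
    exact Function.Surjective.of_comp hf
  · simp [π]
    rfl

open PrimeSpectrum TopologicalSpace in
theorem eq_zero_or_eq_one_of_isIdempotentElem {A : Type*} [CommRing A]
    [ConnectedSpace (PrimeSpectrum A)] {e : A} (he : IsIdempotentElem e) : e = 0 ∨ e = 1 := by
  let E := PrimeSpectrum.isIdempotentElemEquivClopens (R := A)
  have hE : E ⟨e, he⟩ = ⊥ ∨ E ⟨e, he⟩ = ⊤ := by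
    rcases _root_.isClopen_iff.1 (E ⟨e, he⟩).isClopen with h | h
    · exact .inl (Clopens.ext h)
    · exact .inr (Clopens.ext h)
  rcases hE with h | h
  · left
    rw [← E.map_bot] at h
    exact congr_arg Subtype.val (E.injective h)
  · right
    rw [← E.map_top] at h
    exact congr_arg Subtype.val (E.injective h)

theorem finiteType_of_comp_quotientMk {R A : Type*} [CommRing R] [CommRing A] {f : R →+* A}
    {I : Ideal A} (hI : I.FG) (hnil : IsNilpotent I)
    (h : ((Ideal.Quotient.mk I).comp f).FiniteType) : f.FiniteType := by
  let _ : Algebra R A := f.toAlgebra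
  have : Algebra.FiniteType R (A ⧸ I) := h
  exact finiteType_of_finiteType_quotient_of_isNilpotent I hI hnil

/-- A connected ring of finite type over a field is of finite type over some field `l` through which
a given homomorphism from a perfect field factors. -/
theorem exists_coefficientField.{u, v, w} {k : Type v} [Field k] [PerfectField k] {A : Type u}
    [CommRing A] (F : Type w) [Field F] [Algebra F A] [Algebra.FiniteType F A]
    [ConnectedSpace (PrimeSpectrum A)] (φ : k →+* A) :
    ∃ (l : Type u) (_ : Field l) (χ : l →+* A) (ι : k →+* l), χ.FiniteType ∧ χ.comp ι = φ := by
  have : Nontrivial A := PrimeSpectrum.nonempty_iff_nontrivial.1 inferInstance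
  have : IsNoetherianRing A := Algebra.FiniteType.isNoetherianRing F A
  have hnil : IsNilpotent (nilradical A) := IsNoetherianRing.isNilpotent_nilradical A
  let Q := A ⧸ nilradical A
  have : Nontrivial Q := Ideal.Quotient.nontrivial_iff.2 fun h ↦ by
    have : (1 : A) ∈ nilradical A := h ▸ Submodule.mem_top
    exact not_isNilpotent_one (mem_nilradical.1 this)
  have : IsReduced Q := (Ideal.isRadical_iff_quotient_reduced _).1 (Ideal.radical_isRadical _)
  let S := integralClosure F Q
  have hidem (e : S) (he : IsIdempotentElem e) : e = 0 ∨ e = 1 := by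
    obtain ⟨a, ha, hae⟩ := exists_isIdempotentElem_eq_of_ker_isNilpotent
      (Ideal.Quotient.mk (nilradical A))
      (fun x hx ↦ mem_nilradical.1 (by rwa [Ideal.mk_ker] at hx)) (e : Q)
      (Ideal.Quotient.mk_surjective _) (he.map S.subtype)
    rcases eq_zero_or_eq_one_of_isIdempotentElem ha with rfl | rfl
    · exact .inl (Subtype.ext (hae.symm.trans (map_zero _)))
    · exact .inr (Subtype.ext (hae.symm.trans (map_one _)))
  have : IsReduced S := isReduced_of_injective S.val Subtype.val_injective
  let _ : Field S := (isField_of_isIntegral_of_isIdempotentElem (F := F) hidem).toField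
  let ι : k →+* S := ((Ideal.Quotient.mk (nilradical A)).comp φ).codRestrict S
    fun c ↦ isIntegral_of_mem_range_of_field _ c
  let _ : Algebra k A := φ.toAlgebra
  let _ : Algebra k S := ι.toAlgebra
  have : Algebra.FormallySmooth k S := formallySmooth_of_perfectField
  let g : S →ₐ[k] Q := { S.subtype with commutes' := fun _ ↦ rfl }
  obtain ⟨χ, hχ⟩ := Algebra.FormallySmooth.exists_lift (nilradical A) hnil g
  have hχ' (x : S) : Ideal.Quotient.mk (nilradical A) (χ x) = x := DFunLike.congr_fun hχ x
  refine ⟨S, inferInstance, χ.toRingHom, ι, ?_, RingHom.ext fun c ↦ χ.commutes c⟩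
  have hval : (algebraMap S Q).FiniteType :=
    RingHom.finiteType_algebraMap.2 (Algebra.FiniteType.of_restrictScalars_finiteType F S Q)
  rw [show algebraMap S Q = (Ideal.Quotient.mk (nilradical A)).comp χ.toRingHom from
    RingHom.ext fun x ↦ (hχ' x).symm] at hval
  exact finiteType_of_comp_quotientMk (IsNoetherian.noetherian _) hnil hval

/-- **Factorization theorem (Theorem 1.2 = Theorem 4.5(1)), affine form.**
Let `k` be a perfect field, `C` a finite type `k`-algebra, `A` a ring of finite type
over some field with connected prime spectrum, and `φ : C → A` a ring homomorphism.
Then `φ` factors as a morphism of `k`-algebras `ψ : C → B₀` (a model over an integral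
finite type `k`-algebra `R ⊆ l` with fraction field `m ⊆ l`), followed by the
generic-fibre base change `B₀ → m ⊗_R B₀`, followed by the ground-field extension
`m ⊗_R B₀ → l ⊗_m (m ⊗_R B₀) ≅ A`. -/
theorem factorization_of_regular_morphism_affine
    {k : Type} [Field k] [PerfectField k]
    (C : Type) [CommRing C] [Algebra k C] [Algebra.FiniteType k C]
    (A : Type) [CommRing A]
    (F₀ : Type) [Field F₀] [Algebra F₀ A] [Algebra.FiniteType F₀ A]
    [ConnectedSpace (PrimeSpectrum A)]
    (φ : C →+* A) :
    ∃ (l : Type) (fl : Field l),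
      letI : Field l := fl
      ∃ χ : l →+* A,
        (letI : Algebra l A := χ.toAlgebra
         Algebra.FiniteType l A) ∧
        ∃ ι : k →+* l,
          χ.comp ι = φ.comp (algebraMap k C) ∧
          (letI : Algebra k l := ι.toAlgebra
           ∃ R : Subalgebra k l,
             IsDomain R ∧ Algebra.FiniteType k R ∧
             ∃ (m : IntermediateField k l) (hRm : R ≤ m.toSubalgebra),
               letI : Algebra R m := (Subalgebra.inclusion hRm).toAlgebra
               IsFractionRing R m ∧
               ∃ (B₀ : Type) (cB₀ : CommRing B₀),
                 letI : CommRing B₀ := cB₀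
                 ∃ aB₀ : Algebra R B₀,
                   letI : Algebra R B₀ := aB₀
                   Algebra.FiniteType R B₀ ∧
                   (letI : Algebra k B₀ :=
                      ((algebraMap R B₀).comp (algebraMap k R)).toAlgebra
                    letI : Algebra l A := χ.toAlgebra
                    ∃ (ψ : C →ₐ[k] B₀) (Θ : (l ⊗[m] (m ⊗[R] B₀)) ≃ₐ[l] A),
                      ∀ c : C,
                        Θ ((1 : l) ⊗ₜ[m] ((1 : m) ⊗ₜ[R] (ψ c))) = φ c)) := by
  obtain ⟨l, fl, χ, ι, hχ, hχι⟩ := exists_coefficientField F₀ (φ.comp (algebraMap k C))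
  refine ⟨l, fl, χ, hχ, ι, hχι, ?_⟩
  let _ : Algebra k l := ι.toAlgebra
  let _ : Algebra l A := χ.toAlgebra
  let _ : Algebra k A := (φ.comp (algebraMap k C)).toAlgebra
  have : IsScalarTower k l A := .of_algebraMap_eq fun x ↦ (DFunLike.congr_fun hχι x).symm
  have : Algebra.FiniteType l A := hχ
  let φ' : C →ₐ[k] A := { φ with commutes' := fun _ ↦ rfl }
  obtain ⟨n, π, hπ, hπφ⟩ := exists_surjective_tensorProduct_mvPolynomial (l := l) φ'
  have : IsNoetherianRing (l ⊗[k] MvPolynomial (Fin n) C) :=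
    Algebra.FiniteType.isNoetherianRing l _
  obtain ⟨s, hs⟩ := IsNoetherian.noetherian (RingHom.ker π)
  obtain ⟨t, ht⟩ := exists_adjoin_forall_mem_range_map s
  let R := Algebra.adjoin k (t : Set l)
  choose! p hp using ht
  let J : Ideal (R ⊗[k] MvPolynomial (Fin n) C) := Ideal.span (p '' s)
  have hJ : J.map (Algebra.TensorProduct.map (IsScalarTower.toAlgHom k R l) (AlgHom.id k _)) =
      RingHom.ker π := by
    rw [Ideal.map_span, ← hs, ← Set.image_comp]
    exact congr_arg Ideal.span ((Set.image_congr hp).trans (Set.image_id _))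
  obtain ⟨Θ, hΘ⟩ := exists_algEquiv_tensorProduct_quotient π hπ J hJ
  have : Algebra.FiniteType k R := (Subalgebra.fg_iff_finiteType _).1 ⟨t, rfl⟩
  have hRm := IntermediateField.algebra_adjoin_le_adjoin k (t : Set l)
  let m := IntermediateField.adjoin k (t : Set l)
  let B := (R ⊗[k] MvPolynomial (Fin n) C) ⧸ J
  let _ : Algebra R m := (Subalgebra.inclusion hRm).toAlgebra
  have : IsScalarTower R m l := .of_algebraMap_eq fun _ ↦ rfl
  have hfrac : IsFractionRing R m := by
    open scoped IntermediateField.algebraAdjoinAdjoin in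
    exact inferInstanceAs (IsFractionRing (Algebra.adjoin k (t : Set l))
      (IntermediateField.adjoin k (t : Set l)))
  refine ⟨R, inferInstance, inferInstance, m, hRm, hfrac, B, inferInstance, inferInstance,
    inferInstance, ?_⟩
  let _ : Algebra k B := ((algebraMap R B).comp (algebraMap k R)).toAlgebra
  let ψ : C →ₐ[k] B :=
    { (Ideal.Quotient.mk J).comp ((Algebra.TensorProduct.includeRight (R := k) (A := R)
        (B := MvPolynomial (Fin n) C)).toRingHom.comp MvPolynomial.C) with
      commutes' := fun x ↦ congr_arg (Ideal.Quotient.mk J)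
        ((Algebra.TensorProduct.includeRight (R := k) (A := R)
          (B := MvPolynomial (Fin n) C)).commutes x) }
  refine ⟨ψ, (Algebra.TensorProduct.cancelBaseChange R m l l B).trans Θ, fun c ↦ ?_⟩
  rw [AlgEquiv.trans_apply, Algebra.TensorProduct.cancelBaseChange_tmul, one_smul]
  exact (hΘ _).trans (hπφ c)
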